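/- arXiv:2012.10016 — 6 statements merged into one kernel-verified Lean document; each statement's English description precedes it below -/
import Mathlib

section
/- Let L_X be an evaluation code on X and let ≺ be a monomial order on S. Then the dual code (L_X)^⊥ equals the evaluation code (L^⊥)_X of the algebraic dual L^⊥ on X; that is, (L_X)^⊥ = ev(L^⊥). -/
open MvPolynomial

noncomputable section

variable {K : Type*} [Field K] {s m : ℕ}

/-- Evaluation linear map at a family of points. -/
def evalMap (P : Fin m → (Fin s → K)) :
    MvPolynomial (Fin s) K →ₗ[K] (Fin m → K) :=
  LinearMap.pi fun i => (MvPolynomial.aeval (P i)).toLinearMap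

/-- Vanishing ideal of a finite family of points. -/
def vanishingIdeal (P : Fin m → (Fin s → K)) : Ideal (MvPolynomial (Fin s) K) :=
  ⨅ i, RingHom.ker (MvPolynomial.eval (P i))

/-- The linear map `φ : f ↦ ∑ i, f(P i)`. -/
def sumEval (P : Fin m → (Fin s → K)) : MvPolynomial (Fin s) K →ₗ[K] K :=
  ∑ i, (MvPolynomial.aeval (P i)).toLinearMap

/-- The leading exponent (initial monomial exponent) of a polynomial w.r.t. a monomial order. -/
def leadExpo (mo : MonomialOrder (Fin s)) (f : MvPolynomial (Fin s) K) : Fin s →₀ ℕ :=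
  mo.toSyn.symm (f.support.sup fun a => mo.toSyn a)

/-- The initial ideal of `I` w.r.t. a monomial order. -/
def initialIdeal (mo : MonomialOrder (Fin s)) (I : Ideal (MvPolynomial (Fin s) K)) :
    Ideal (MvPolynomial (Fin s) K) :=
  Ideal.span ((fun f => (monomial (leadExpo mo f) (1 : K))) '' {f | f ∈ I ∧ f ≠ 0})

/-- The set of exponents of standard monomials of `S/I`. -/
def stdMon (mo : MonomialOrder (Fin s)) (I : Ideal (MvPolynomial (Fin s) K)) :
    Set (Fin s →₀ ℕ) :=
  {a | monomial a (1 : K) ∉ initialIdeal mo I}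

/-- `K Δ_≺(I)`, the span of the standard monomials. -/
def stdSpan (mo : MonomialOrder (Fin s)) (I : Ideal (MvPolynomial (Fin s) K)) :
    Submodule K (MvPolynomial (Fin s) K) :=
  Submodule.span K ((fun a => monomial a (1 : K)) '' stdMon mo I)

/-- The space `(ker φ : L) = {g | g·f ∈ ker φ for all f ∈ L}`. -/
def colonKer (φ : MvPolynomial (Fin s) K →ₗ[K] K)
    (L : Submodule K (MvPolynomial (Fin s) K)) : Submodule K (MvPolynomial (Fin s) K) where
  carrier := {g | ∀ f ∈ L, φ (g * f) = 0}
  add_mem' := fun ha hb f hf => by rw [add_mul, map_add, ha f hf, hb f hf, add_zero]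
  zero_mem' := fun f hf => by rw [zero_mul, map_zero]
  smul_mem' := fun c a ha f hf => by rw [smul_mul_assoc, map_smul, ha f hf, smul_zero]

/-- The algebraic dual `L^⊥ = (ker φ : L) ∩ KΔ_≺(I)`. -/
def algDual (P : Fin m → (Fin s → K)) (mo : MonomialOrder (Fin s))
    (L : Submodule K (MvPolynomial (Fin s) K)) : Submodule K (MvPolynomial (Fin s) K) :=
  colonKer (sumEval P) L ⊓ stdSpan mo (vanishingIdeal P)

/-- The dual of a linear code in `K^m`. -/
def dualCode (C : Submodule K (Fin m → K)) : Submodule K (Fin m → K) where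
  carrier := {α | ∀ β ∈ C, ∑ i, α i * β i = 0}
  add_mem' := fun ha hb β hβ => by
    simp only [Pi.add_apply, add_mul, Finset.sum_add_distrib]
    rw [ha β hβ, hb β hβ, add_zero]
  zero_mem' := fun β hβ => by simp
  smul_mem' := fun c a ha β hβ => by
    simp only [Pi.smul_apply, smul_eq_mul, mul_assoc, ← Finset.mul_sum]
    rw [ha β hβ, mul_zero]

/-- Coordinatewise scaling of `K^m` by a vector `β`. -/
def scaleMap (β : Fin m → K) : (Fin m → K) →ₗ[K] (Fin m → K) :=
  LinearMap.pi fun i => β i • LinearMap.proj i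

/-- A monomial order is graded if it refines total degree. -/
def MonomialOrder.IsGraded (mo : MonomialOrder (Fin s)) : Prop :=
  ∀ a b : Fin s →₀ ℕ, Finsupp.degree a < Finsupp.degree b → mo.toSyn a < mo.toSyn b

/-- The affine Hilbert function of the vanishing ideal of the points `P`. -/
def hilbA (P : Fin m → (Fin s → K)) (d : ℕ) : ℕ :=
  Module.finrank K
    (Submodule.map (Ideal.Quotient.mkₐ K (vanishingIdeal P)).toLinearMap
      (restrictTotalDegree (Fin s) K d))

/-- The affine Hilbert function, with `H(d) = 0` for `d < 0`. -/
def hilbAZ (P : Fin m → (Fin s → K)) (d : ℤ) : ℕ :=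
  if d < 0 then 0 else hilbA P d.toNat

/-- The Reed–Muller-type code of degree `d` on the points `P`. -/
def RMcode (P : Fin m → (Fin s → K)) (d : ℕ) : Submodule K (Fin m → K) :=
  Submodule.map (evalMap P) (restrictTotalDegree (Fin s) K d)

/-- The Reed–Muller-type code indexed by an integer degree, `⊥` for `d < 0`. -/
def RMcodeZ (P : Fin m → (Fin s → K)) (d : ℤ) : Submodule K (Fin m → K) :=
  if d < 0 then ⊥ else RMcode P d.toNat

/-- The vanishing ideal of a single point. -/
def pointIdeal (Q : Fin s → K) : Ideal (MvPolynomial (Fin s) K) :=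
  RingHom.ker (MvPolynomial.eval Q)

/-- The local v-number `v_𝔭(I)`. -/
def vNumAt (I 𝔭 : Ideal (MvPolynomial (Fin s) K)) : ℕ :=
  sInf {d | ∃ f : MvPolynomial (Fin s) K, f ≠ 0 ∧ f.totalDegree = d ∧
    I.colon (Ideal.span {f}) = 𝔭}

/-- `f` is an indicator function for the `i`-th point. -/
def IsIndicator (P : Fin m → (Fin s → K)) (f : MvPolynomial (Fin s) K) (i : Fin m) : Prop :=
  MvPolynomial.eval (P i) f ≠ 0 ∧ ∀ j, j ≠ i → MvPolynomial.eval (P j) f = 0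

/-- The minimum distance of a linear code. -/
def minDist (C : Submodule K (Fin m → K)) : ℕ :=
  sInf {w | ∃ v ∈ C, v ≠ 0 ∧ Set.ncard {i | v i ≠ 0} = w}

lemma mem_vanishingIdeal_iff {P : Fin m → (Fin s → K)} {f : MvPolynomial (Fin s) K} :
    f ∈ vanishingIdeal P ↔ ∀ i, MvPolynomial.eval (P i) f = 0 := by
  simp [_root_.vanishingIdeal, RingHom.mem_ker]

lemma evalMap_apply (P : Fin m → (Fin s → K)) (f : MvPolynomial (Fin s) K) (i : Fin m) :
    evalMap P f i = MvPolynomial.eval (P i) f := by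
  simp [evalMap, MvPolynomial.aeval_eq_eval]

lemma sumEval_apply (P : Fin m → (Fin s → K)) (f : MvPolynomial (Fin s) K) :
    sumEval P f = ∑ i, MvPolynomial.eval (P i) f := by
  simp [sumEval, MvPolynomial.aeval_eq_eval]

lemma monomial_mem_initialIdeal_iff {mo : MonomialOrder (Fin s)}
    {I : Ideal (MvPolynomial (Fin s) K)} {a : Fin s →₀ ℕ} :
    monomial a (1 : K) ∈ initialIdeal mo I ↔ ∃ f ∈ I, f ≠ 0 ∧ mo.degree f ≤ a := by
  have h : initialIdeal mo I = Ideal.span ((fun b => monomial b (1 : K)) ''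
      (mo.degree '' {f : MvPolynomial (Fin s) K | f ∈ I ∧ f ≠ 0})) := by
    rw [Set.image_image]
    rfl
  rw [h, mem_ideal_span_monomial_image]
  simp [and_assoc]

/-- Every polynomial is congruent modulo `I` to a combination of standard monomials. -/
lemma exists_mem_stdSpan_sub_mem (mo : MonomialOrder (Fin s))
    (I : Ideal (MvPolynomial (Fin s) K)) (f : MvPolynomial (Fin s) K) :
    ∃ r ∈ stdSpan mo I, f - r ∈ I := by
  obtain ⟨g, r, hfr, -, hr⟩ := mo.div_set (B := {b | b ∈ I ∧ b ≠ 0})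
    (fun b hb => (mo.leadingCoeff_ne_zero_iff.mpr hb.2).isUnit) f
  refine ⟨r, ?_, ?_⟩
  · rw [r.as_sum]
    refine Submodule.sum_mem _ fun c hc => ?_
    rw [← mul_one (coeff c r), ← smul_eq_mul, ← smul_monomial]
    refine Submodule.smul_mem _ _ (Submodule.subset_span ⟨c, fun hmem => ?_, rfl⟩)
    obtain ⟨b, hbI, hb0, hbc⟩ := monomial_mem_initialIdeal_iff.mp hmem
    exact hr c hc b ⟨hbI, hb0⟩ hbc
  · rw [hfr, add_sub_cancel_right, Finsupp.linearCombination_apply]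
    exact Ideal.sum_mem _ fun b _ => I.mul_mem_left _ b.2.1

lemma evalMap_surjective [Fintype K] {P : Fin m → (Fin s → K)} (hP : Function.Injective P) :
    Function.Surjective (evalMap P) := by
  intro α
  refine ⟨∑ i, α i • indicator (P i), funext fun j => ?_⟩
  rw [evalMap_apply, map_sum, Finset.sum_eq_single j]
  · simp [smul_eval, eval_indicator_apply_eq_one]
  · intro i _ hij
    rw [smul_eval, eval_indicator_apply_eq_zero _ _ (hP.ne hij.symm), mul_zero]
  · simp

/-- The standard monomials span the whole ambient space of the code after evaluation. -/
lemma exists_mem_stdSpan_evalMap_eq [Fintype K] {P : Fin m → (Fin s → K)}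
    (hP : Function.Injective P) (mo : MonomialOrder (Fin s)) (α : Fin m → K) :
    ∃ r ∈ stdSpan mo (vanishingIdeal P), evalMap P r = α := by
  obtain ⟨f, rfl⟩ := evalMap_surjective hP α
  obtain ⟨r, hr, hfr⟩ := exists_mem_stdSpan_sub_mem mo (vanishingIdeal P) f
  refine ⟨r, hr, funext fun i => ?_⟩
  have := mem_vanishingIdeal_iff.mp hfr i
  rw [map_sub, sub_eq_zero] at this
  rw [evalMap_apply, evalMap_apply, this]

lemma evalMap_mem_dualCode_iff {P : Fin m → (Fin s → K)}
    {L : Submodule K (MvPolynomial (Fin s) K)} {g : MvPolynomial (Fin s) K} :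
    evalMap P g ∈ dualCode (Submodule.map (evalMap P) L) ↔ g ∈ colonKer (sumEval P) L := by
  change (∀ β ∈ Submodule.map (evalMap P) L, ∑ i, evalMap P g i * β i = 0) ↔
    ∀ f ∈ L, sumEval P (g * f) = 0
  simp [Submodule.mem_map, evalMap_apply, sumEval_apply]

/-- The dual of an evaluation code is the evaluation code of the algebraic dual. -/
theorem dual_of_evaluation_code [Fintype K]
    (P : Fin m → (Fin s → K)) (hP : Function.Injective P) (hm : 2 ≤ m)
    (mo : MonomialOrder (Fin s))
    (L : Submodule K (MvPolynomial (Fin s) K)) (hL : Module.Finite K L) :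
    dualCode (Submodule.map (evalMap P) L) =
      Submodule.map (evalMap P) (algDual P mo L) := by
  apply le_antisymm
  · intro α hα
    obtain ⟨r, hr, rfl⟩ := exists_mem_stdSpan_evalMap_eq hP mo α
    exact ⟨r, ⟨evalMap_mem_dualCode_iff.mp hα, hr⟩, rfl⟩
  · rintro _ ⟨g, hg, rfl⟩
    exact evalMap_mem_dualCode_iff.mpr hg.1

end
end

section
/- Suppose the vanishing ideal I(X) is a binomial ideal, i.e. it is generated by elements of the form t^a − t^b, and suppose L is a K-linear subspace of S spanned by finitely many monomials. Then L_X is a standard monomial code: the unique K-linear subspace L̃ of KΔ_≺(I) with ev(L̃) = ev(L) is spanned by a set of monomials. -/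
open MvPolynomial

noncomputable section

variable {K : Type*} [Field K] {s m : ℕ}

theorem mem_vanishingIdeal_iff_evalMap_eq_zero (P : Fin m → (Fin s → K))
    (f : MvPolynomial (Fin s) K) :
    f ∈ vanishingIdeal P ↔ evalMap P f = 0 := by
  simp [_root_.vanishingIdeal, evalMap, _root_.funext_iff, RingHom.mem_ker, aeval_eq_eval]

/-- The algebra map sending a monomial to the basis element indexed by its vector of values. -/
def valueAlgHom (P : Fin m → (Fin s → K)) :
    MvPolynomial (Fin s) K →ₐ[K] MonoidAlgebra K (Fin m → K) :=
  aeval fun i => MonoidAlgebra.of K (Fin m → K) fun j => P j i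

theorem valueAlgHom_monomial (P : Fin m → (Fin s → K)) (a : Fin s →₀ ℕ) (c : K) :
    valueAlgHom P (monomial a c) =
      MonoidAlgebra.single (evalMap P (monomial a (1 : K))) c := by
  have h : evalMap P (monomial a (1 : K)) = a.prod fun i n => (fun j => P j i) ^ n := by
    ext j
    simp [evalMap, aeval_monomial, Finsupp.prod, Finset.prod_apply]
  rw [valueAlgHom, aeval_monomial, h]
  simp only [← map_pow]
  rw [← map_finsuppProd]
  simp [MonoidAlgebra.of_apply]

theorem valueAlgHom_eq_zero_of_mem (P : Fin m → (Fin s → K))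
    {G : Set (MvPolynomial (Fin s) K)}
    (hG : ∀ g ∈ G, ∃ a b : Fin s →₀ ℕ, g = monomial a (1 : K) - monomial b (1 : K))
    (hI : vanishingIdeal P = Ideal.span G) {f : MvPolynomial (Fin s) K}
    (hf : f ∈ vanishingIdeal P) : valueAlgHom P f = 0 := by
  suffices vanishingIdeal P ≤ RingHom.ker (valueAlgHom P) from this hf
  rw [hI, Ideal.span_le]
  intro g hg
  have hgI : g ∈ vanishingIdeal P := hI ▸ Ideal.subset_span hg
  obtain ⟨a, b, rfl⟩ := hG g hg
  rw [mem_vanishingIdeal_iff_evalMap_eq_zero, map_sub, sub_eq_zero] at hgI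
  simp [RingHom.mem_ker, valueAlgHom_monomial, hgI]

/-- An exponent in the support of an element of the kernel shares its value vector with another
exponent in the support. -/
theorem exists_ne_of_valueAlgHom_eq_zero (P : Fin m → (Fin s → K))
    {f : MvPolynomial (Fin s) K} (hf : valueAlgHom P f = 0) {c : Fin s →₀ ℕ}
    (hc : c ∈ f.support) :
    ∃ b ∈ f.support, b ≠ c ∧
      evalMap P (monomial b (1 : K)) = evalMap P (monomial c (1 : K)) := by
  by_contra! h
  have hsum : valueAlgHom P f = ∑ a ∈ f.support,
      MonoidAlgebra.single (evalMap P (monomial a (1 : K))) (coeff a f) := by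
    conv_lhs => rw [f.as_sum, map_sum]
    simp only [valueAlgHom_monomial]
  have hcoeff := congrArg (fun x => x.coeff (evalMap P (monomial c (1 : K)))) (hsum.symm.trans hf)
  simp only [MonoidAlgebra.coeff_sum, MonoidAlgebra.coeff_single, MonoidAlgebra.coeff_zero,
    Finsupp.finsetSum_apply, Finsupp.coe_zero, Pi.zero_apply] at hcoeff
  rw [Finset.sum_eq_single c (fun b hb hbc => Finsupp.single_eq_of_ne (h b hb hbc).symm)
    (fun hn => absurd hc hn), Finsupp.single_eq_same] at hcoeff
  exact mem_support_iff.mp hc hcoeff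

/-- A minimal exponent among those with a given value vector is standard. -/
theorem mem_stdMon_of_minimal (P : Fin m → (Fin s → K)) (mo : MonomialOrder (Fin s))
    (hI : ∀ f ∈ vanishingIdeal P, valueAlgHom P f = 0) {c : Fin s →₀ ℕ}
    (hmin : ∀ b, evalMap P (monomial b (1 : K)) = evalMap P (monomial c (1 : K)) →
      mo.toSyn c ≤ mo.toSyn b) :
    c ∈ stdMon mo (vanishingIdeal P) := by
  intro hc
  have himage : initialIdeal mo (vanishingIdeal P) = Ideal.span
      ((fun a => monomial a (1 : K)) '' (leadExpo mo '' {f | f ∈ vanishingIdeal P ∧ f ≠ 0})) := by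
    rw [initialIdeal, Set.image_image]
  rw [himage, mem_ideal_span_monomial_image] at hc
  obtain ⟨_, ⟨f, ⟨hf, hf0⟩, rfl⟩, hle⟩ := hc c (by simp [mem_support_iff])
  obtain ⟨e, rfl⟩ := exists_add_of_le hle
  have hdeg : leadExpo mo f = mo.degree f := rfl
  have hker : valueAlgHom P (f * monomial e (1 : K)) = 0 :=
    hI _ (Ideal.mul_mem_right _ _ hf)
  have hmem : leadExpo mo f + e ∈ (f * monomial e (1 : K)).support := by
    rw [mem_support_iff, coeff_mul_monomial, mul_one, hdeg]
    exact mo.leadingCoeff_ne_zero_iff.mpr hf0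
  obtain ⟨b, hb, hne, heq⟩ := exists_ne_of_valueAlgHom_eq_zero P hker hmem
  have hbe : mo.toSyn (mo.degree (f * monomial e (1 : K))) ≤ mo.toSyn (leadExpo mo f + e) := by
    refine mo.degree_mul_le.trans ?_
    rw [hdeg, map_add, map_add]
    gcongr
    exact mo.degree_monomial_le 1
  exact hne (mo.toSyn.injective (((mo.le_degree hb).trans hbe).antisymm (hmin b heq)))

/-- Every monomial has the same values on the points as some standard monomial. -/
theorem exists_mem_stdMon_evalMap_eq (P : Fin m → (Fin s → K)) (mo : MonomialOrder (Fin s))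
    (hI : ∀ f ∈ vanishingIdeal P, valueAlgHom P f = 0) (a : Fin s →₀ ℕ) :
    ∃ c ∈ stdMon mo (vanishingIdeal P),
      evalMap P (monomial c (1 : K)) = evalMap P (monomial a (1 : K)) := by
  obtain ⟨c, hc, hmin⟩ := (InvImage.wf mo.toSyn mo.wellFoundedLT_syn.wf).has_min
    {b | evalMap P (monomial b (1 : K)) = evalMap P (monomial a (1 : K))} ⟨a, rfl⟩
  exact ⟨c, mem_stdMon_of_minimal P mo hI fun b hb => not_lt.mp (hmin b (hb.trans hc)), hc⟩

/-- If the vanishing ideal is binomial and `L` is a monomial space,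
then `L_X` is a standard monomial code. -/
theorem binomial_ideal_standard_monomial_code [Fintype K]
    (P : Fin m → (Fin s → K)) (hP : Function.Injective P) (hm : 2 ≤ m)
    (mo : MonomialOrder (Fin s))
    (hbin : ∃ G : Set (MvPolynomial (Fin s) K),
      (∀ g ∈ G, ∃ a b : Fin s →₀ ℕ, g = monomial a (1 : K) - monomial b (1 : K)) ∧
      vanishingIdeal P = Ideal.span G)
    (L : Submodule K (MvPolynomial (Fin s) K))
    (hL : ∃ A : Finset (Fin s →₀ ℕ),
      L = Submodule.span K ((fun a => monomial a (1 : K)) '' A)) :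
    ∃ Γ : Set (Fin s →₀ ℕ), Γ ⊆ stdMon mo (vanishingIdeal P) ∧
      Submodule.map (evalMap P)
          (Submodule.span K ((fun a => monomial a (1 : K)) '' Γ)) =
        Submodule.map (evalMap P) L := by
  obtain ⟨G, hG, hspan⟩ := hbin
  obtain ⟨A, rfl⟩ := hL
  choose c hc hev using exists_mem_stdMon_evalMap_eq P mo
    fun f hf => valueAlgHom_eq_zero_of_mem P hG hspan hf
  refine ⟨c '' A, Set.image_subset_iff.mpr fun a _ => hc a, ?_⟩
  simp only [Submodule.map_span, Set.image_image, hev]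

end
end

section
/- Let P_i ∈ X and let 𝔭_i = I({P_i}) be the vanishing ideal of the point P_i. Then the K-vector space (I : 𝔭_i)/I has dimension 1, and (I : 𝔭_i)/I = K·(f + I) for any indicator function f for P_i. -/
open MvPolynomial

noncomputable section

variable {K : Type*} [Field K] {s m : ℕ}

theorem mem_vanishingIdeal {P : Fin m → (Fin s → K)} {g : MvPolynomial (Fin s) K} :
    g ∈ vanishingIdeal P ↔ ∀ j, eval (P j) g = 0 := by
  simp [_root_.vanishingIdeal, RingHom.mem_ker]

theorem isIndicator_indicator [Fintype K] {P : Fin m → (Fin s → K)}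
    (hP : Function.Injective P) (i : Fin m) : IsIndicator P (indicator (P i)) i := by
  refine ⟨?_, fun j hj => eval_indicator_apply_eq_zero _ _ (hP.ne hj)⟩
  rw [eval_indicator_apply_eq_one]
  exact one_ne_zero

/-- Multipliers of `𝔭ᵢ` into `I` are the polynomials vanishing at all points but the `i`-th. -/
theorem mem_colon_pointIdeal [Fintype K] {P : Fin m → (Fin s → K)}
    (hP : Function.Injective P) {i : Fin m} {g : MvPolynomial (Fin s) K} :
    g ∈ (vanishingIdeal P).colon (pointIdeal (P i)) ↔ ∀ j, j ≠ i → eval (P j) g = 0 := by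
  simp only [Submodule.mem_colon, smul_eq_mul, mem_vanishingIdeal, map_mul]
  constructor
  · intro h j hj
    have hmem : indicator (P j) ∈ pointIdeal (P i) :=
      eval_indicator_apply_eq_zero _ _ (hP.ne hj.symm)
    simpa [eval_indicator_apply_eq_one] using h _ hmem j
  · intro h p hp j
    by_cases hj : j = i
    · subst hj
      rw [show eval (P j) p = 0 from hp, mul_zero]
    · rw [h j hj, zero_mul]

theorem map_colon_pointIdeal_eq_span [Fintype K] {P : Fin m → (Fin s → K)}
    (hP : Function.Injective P) {i : Fin m} {f : MvPolynomial (Fin s) K}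
    (hf : IsIndicator P f i) :
    Submodule.map (Ideal.Quotient.mkₐ K (vanishingIdeal P)).toLinearMap
        (Submodule.restrictScalars K
          ((vanishingIdeal P).colon (pointIdeal (P i)))) =
      Submodule.span K {Ideal.Quotient.mk (vanishingIdeal P) f} := by
  apply le_antisymm
  · rintro _ ⟨g, hg, rfl⟩
    have hg' := (mem_colon_pointIdeal hP).1 hg
    refine Submodule.mem_span_singleton.2 ⟨eval (P i) g / eval (P i) f, ?_⟩
    change Ideal.Quotient.mk (vanishingIdeal P) ((eval (P i) g / eval (P i) f) • f) =
      Ideal.Quotient.mk (vanishingIdeal P) g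
    rw [Ideal.Quotient.eq, mem_vanishingIdeal]
    intro j
    rw [map_sub, smul_eval]
    by_cases hj : j = i
    · subst hj
      rw [div_mul_cancel₀ _ hf.1, sub_self]
    · rw [hf.2 j hj, hg' j hj, mul_zero, sub_zero]
  · rw [Submodule.span_singleton_le_iff_mem]
    exact ⟨f, (mem_colon_pointIdeal hP).2 hf.2, rfl⟩

/-- `(I : 𝔭ᵢ)/I` is one-dimensional, spanned by the class of any indicator function. -/
theorem colon_quotient_dim_one [Fintype K]
    (P : Fin m → (Fin s → K)) (hP : Function.Injective P) (hm : 2 ≤ m) (i : Fin m) :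
    Module.finrank K
        (Submodule.map (Ideal.Quotient.mkₐ K (vanishingIdeal P)).toLinearMap
          (Submodule.restrictScalars K
            ((vanishingIdeal P).colon (pointIdeal (P i))))) = 1 ∧
    ∀ f : MvPolynomial (Fin s) K, IsIndicator P f i →
      Submodule.map (Ideal.Quotient.mkₐ K (vanishingIdeal P)).toLinearMap
          (Submodule.restrictScalars K
            ((vanishingIdeal P).colon (pointIdeal (P i)))) =
        Submodule.span K {Ideal.Quotient.mk (vanishingIdeal P) f} := by
  refine ⟨?_, fun f hf => map_colon_pointIdeal_eq_span hP hf⟩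
  have hf := isIndicator_indicator hP i
  rw [map_colon_pointIdeal_eq_span hP hf]
  refine finrank_span_singleton fun h => hf.1 ?_
  exact mem_vanishingIdeal.1 (Ideal.Quotient.eq_zero_iff_mem.1 h) i

end
end

section
/- Let P_i ∈ X, let 𝔭_i = I({P_i}) be the vanishing ideal of P_i, and define v_{𝔭_i}(I) = min{d ≥ 0 : there exists a nonzero f ∈ S of degree d with (I : f) = 𝔭_i}. Then v_{𝔭_i}(I) equals the least total degree of an indicator function for P_i. -/
open MvPolynomial

noncomputable section

variable {K : Type*} [Field K] {s m : ℕ}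

theorem mem_vanishingIdeal_family_iff (P : Fin m → (Fin s → K)) (f : MvPolynomial (Fin s) K) :
    f ∈ vanishingIdeal P ↔ ∀ j, eval (P j) f = 0 := by
  simp [_root_.vanishingIdeal, RingHom.mem_ker]

theorem mem_vanishingIdeal_colon_span_singleton_iff (P : Fin m → (Fin s → K))
    (f g : MvPolynomial (Fin s) K) :
    g ∈ (vanishingIdeal P).colon (Ideal.span {f}) ↔
      ∀ j, eval (P j) g = 0 ∨ eval (P j) f = 0 := by
  simp [mem_vanishingIdeal_family_iff]

/-- Over a finite field, indicator functions are exactly the polynomials `f` for which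
`I(X) : f` is the vanishing ideal of the point. -/
theorem vanishingIdeal_colon_eq_pointIdeal_iff [Fintype K] (P : Fin m → (Fin s → K))
    (hP : Function.Injective P) (i : Fin m) (f : MvPolynomial (Fin s) K) :
    (vanishingIdeal P).colon (Ideal.span {f}) = pointIdeal (P i) ↔ IsIndicator P f i := by
  simp only [SetLike.ext_iff, mem_vanishingIdeal_colon_span_singleton_iff, pointIdeal,
    RingHom.mem_ker]
  constructor
  · intro h
    refine ⟨fun hf => ?_, fun j hj => ?_⟩
    · refine one_ne_zero ((eval_indicator_apply_eq_one (P i)).symm.trans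
        ((h (indicator (P i))).1 fun j => ?_))
      by_cases hj : j = i
      · exact Or.inr (hj ▸ hf)
      · exact Or.inl (eval_indicator_apply_eq_zero _ _ (hP.ne hj))
    · refine ((h (indicator (P j))).2
        (eval_indicator_apply_eq_zero _ _ (hP.ne hj.symm)) j).resolve_left ?_
      rw [eval_indicator_apply_eq_one]
      exact one_ne_zero
  · rintro ⟨hi, hne⟩ g
    refine ⟨fun h => (h i).resolve_right hi, fun h j => ?_⟩
    by_cases hj : j = i
    · exact Or.inl (hj ▸ h)
    · exact Or.inr (hne j hj)

theorem IsIndicator.ne_zero {P : Fin m → (Fin s → K)} {f : MvPolynomial (Fin s) K} {i : Fin m}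
    (h : IsIndicator P f i) : f ≠ 0 := by
  rintro rfl
  exact h.1 (map_zero _)

/-- The local v-number at a point is the least degree of an indicator function for that point. -/
theorem vNumAt_eq_min_degree_indicator [Fintype K]
    (P : Fin m → (Fin s → K)) (hP : Function.Injective P) (hm : 2 ≤ m) (i : Fin m) :
    vNumAt (vanishingIdeal P) (pointIdeal (P i)) =
      sInf {d : ℕ | ∃ f : MvPolynomial (Fin s) K,
        IsIndicator P f i ∧ f.totalDegree = d} := by
  unfold vNumAt
  congr! 5 with d f
  rw [vanishingIdeal_colon_eq_pointIdeal_iff P hP]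
  exact ⟨fun h => ⟨h.2.2, h.2.1⟩, fun h => ⟨h.1.ne_zero, h.2, h.1⟩⟩

end
end

section
/- Let 𝔭_1,…,𝔭_m be the vanishing ideals of the points P_1,…,P_m of X (these are the associated primes of I = I(X)). Then for each i, v_{𝔭_i}(I) = α((I : 𝔭_i)/I), where α(M) denotes the minimum total degree of an f ∈ S with f ∉ I and f + I ∈ M; consequently v(I) = min{α((I : 𝔭_i)/I) : 1 ≤ i ≤ m}. -/
open MvPolynomial

noncomputable section

variable {K : Type*} [Field K] {s m : ℕ}

theorem pointIdeal_isMaximal (Q : Fin s → K) : (pointIdeal Q).IsMaximal :=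
  RingHom.ker_isMaximal_of_surjective _ fun c => ⟨C c, eval_C c⟩

theorem Ideal.colon_span_singleton_eq_iff {R : Type*} [CommRing R] {I J : Ideal R}
    (hJ : J.IsMaximal) (f : R) :
    I.colon (Ideal.span {f}) = J ↔ f ∉ I ∧ f ∈ I.colon J := by
  have mem_iff (g : R) : g ∈ I.colon (Ideal.span {f}) ↔ g * f ∈ I := by
    rw [Submodule.mem_colon]
    refine ⟨fun h => h f (Ideal.mem_span_singleton_self f), fun h p hp => ?_⟩
    obtain ⟨c, rfl⟩ := Ideal.mem_span_singleton'.mp hp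
    rw [smul_eq_mul, mul_left_comm]
    exact I.mul_mem_left c h
  have one_mem : (1 : R) ∈ I.colon (Ideal.span {f}) ↔ f ∈ I := by rw [mem_iff, one_mul]
  constructor
  · intro h
    refine ⟨fun hf => hJ.ne_top ((Ideal.eq_top_iff_one _).mpr (h ▸ one_mem.mpr hf)), ?_⟩
    refine Submodule.mem_colon.mpr fun g hg => ?_
    rw [smul_eq_mul, mul_comm]
    exact (mem_iff g).mp (h ▸ hg)
  · rintro ⟨hf, hc⟩
    refine (hJ.eq_of_le (fun h => hf (one_mem.mp ((Ideal.eq_top_iff_one _).mp h)))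
      fun g hg => (mem_iff g).mpr ?_).symm
    rw [mul_comm]
    exact Submodule.mem_colon.mp hc g hg

theorem Ideal.mk_mem_map_colon_iff {R : Type*} [CommRing R] (I J : Ideal R) (f : R) :
    Ideal.Quotient.mk I f ∈ Ideal.map (Ideal.Quotient.mk I) (I.colon J) ↔ f ∈ I.colon J := by
  rw [← Ideal.mem_comap, Ideal.comap_map_of_surjective _ Ideal.Quotient.mk_surjective,
    ← RingHom.ker_eq_comap_bot, Ideal.mk_ker, sup_eq_left.mpr]
  exact fun g hg => Submodule.mem_colon.mpr fun p _ => I.mul_mem_right p hg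

theorem vNumAt_eq_sInf_of_isMaximal (I : Ideal (MvPolynomial (Fin s) K))
    {J : Ideal (MvPolynomial (Fin s) K)} (hJ : J.IsMaximal) :
    vNumAt I J = sInf {d : ℕ | ∃ f : MvPolynomial (Fin s) K, f ∉ I ∧
      Ideal.Quotient.mk I f ∈ Ideal.map (Ideal.Quotient.mk I) (I.colon J) ∧
      f.totalDegree = d} := by
  unfold vNumAt
  congr 1
  ext d
  refine exists_congr fun f => ?_
  rw [Ideal.colon_span_singleton_eq_iff hJ, Ideal.mk_mem_map_colon_iff]
  exact ⟨fun ⟨_, hd, hf, hc⟩ => ⟨hf, hc, hd⟩,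
    fun ⟨hf, hc, hd⟩ => ⟨fun h => hf (h ▸ I.zero_mem), hd, hf, hc⟩⟩

/-- `v_{𝔭ᵢ}(I) = α((I : 𝔭ᵢ)/I)` for all `i`, and `v(I)` is the minimum of these numbers. -/
theorem vNumAt_eq_alpha_colon [Fintype K]
    (P : Fin m → (Fin s → K)) (hP : Function.Injective P) (hm : 2 ≤ m) :
    (∀ i : Fin m,
      vNumAt (vanishingIdeal P) (pointIdeal (P i)) =
        sInf {d : ℕ | ∃ f : MvPolynomial (Fin s) K, f ∉ vanishingIdeal P ∧
          Ideal.Quotient.mk (vanishingIdeal P) f ∈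
            Ideal.map (Ideal.Quotient.mk (vanishingIdeal P))
              ((vanishingIdeal P).colon (pointIdeal (P i))) ∧
          f.totalDegree = d}) ∧
    (⨅ i : Fin m, vNumAt (vanishingIdeal P) (pointIdeal (P i))) =
      ⨅ i : Fin m, sInf {d : ℕ | ∃ f : MvPolynomial (Fin s) K, f ∉ vanishingIdeal P ∧
        Ideal.Quotient.mk (vanishingIdeal P) f ∈
          Ideal.map (Ideal.Quotient.mk (vanishingIdeal P))
            ((vanishingIdeal P).colon (pointIdeal (P i))) ∧
        f.totalDegree = d} := by
  have h (i : Fin m) := vNumAt_eq_sInf_of_isMaximal (vanishingIdeal P) (pointIdeal_isMaximal (P i))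
  exact ⟨h, iInf_congr h⟩

end
end

section
/- Let T = A_1 × ⋯ × A_s be a degenerate torus, I = I(T), and let ≺ be a graded monomial order, so Δ_≺(I) = {t^c : 0 ≤ c_i ≤ d_i − 1 for all i}. Let L have a basis of standard monomials A = {t^{a_1},…,t^{a_k}} ⊆ Δ_≺(I). For each i set t^{b_i} = 1 if t^{a_i} = 1 and t^{b_i} = ∏_{j : a_{i,j} > 0} t_j^{d_j − a_{i,j}} otherwise, and let B = {t^{b_1},…,t^{b_k}}. Then the algebraic dual satisfies L^⊥ = K(Δ_≺(I) \ B), the K-span of the standard monomials not in B. -/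
open MvPolynomial

noncomputable section

variable {K : Type*} [Field K] {s m : ℕ}

/-- The sum of all `e`-th powers of the elements of a finite subgroup of the units of a field. -/
theorem sum_pow_subgroup_units (H : Subgroup Kˣ) [Fintype H] (e : ℕ) :
    ∑ u : H, ((u : Kˣ) : K) ^ e =
      if Nat.card H ∣ e then ((Nat.card H : ℕ) : K) else 0 := by
  classical
  let f : H →* K := ((Units.coeHom K).comp H.subtype).comp (powMonoidHom e)
  have hf : f = 1 ↔ Nat.card H ∣ e := by
    rw [← IsCyclic.exponent_eq_card, Monoid.exponent_dvd_iff_forall_pow_eq_one, DFunLike.ext_iff]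
    refine forall_congr' fun u => ?_
    simp [f, Subtype.ext_iff, Units.ext_iff]
  have h := sum_hom_units f
  simp only [hf] at h
  rw [Nat.card_eq_fintype_card] at h ⊢
  push_cast at h
  rw [← h]
  refine Finset.sum_congr rfl fun u _ => ?_
  simp [f]

/-- The order of a subgroup of the units of a finite field is nonzero in the field. -/
theorem natCast_card_subgroup_units_ne_zero [Fintype K] (H : Subgroup Kˣ) :
    ((Nat.card H : ℕ) : K) ≠ 0 := by
  intro h
  obtain ⟨r, hr⟩ := H.card_subgroup_dvd_card
  have hu : ((Nat.card Kˣ : ℕ) : K) = 0 := by rw [hr, Nat.cast_mul, h, zero_mul]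
  have hc : Nat.card Kˣ + 1 = Fintype.card K := by
    rw [Nat.card_units, Nat.card_eq_fintype_card]
    have := Fintype.card_pos (α := K)
    omega
  have := congrArg (Nat.cast : ℕ → K) hc
  rw [Nat.cast_add, hu, Nat.cast_card_eq_zero] at this
  simp at this

/-- The sum of the values of a monomial over a degenerate torus. -/
theorem sumEval_monomial_degenerate_torus [Fintype K]
    (A : Fin s → Subgroup Kˣ) (P : Fin m → (Fin s → K)) (hP : Function.Injective P)
    (hrange : Set.range P = {x : Fin s → K | ∀ i, ∃ u ∈ A i, (u : K) = x i})
    (e : Fin s →₀ ℕ) :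
    sumEval P (monomial e (1 : K)) =
      ∏ j, if Nat.card (A j) ∣ e j then ((Nat.card (A j) : ℕ) : K) else 0 := by
  classical
  simp only [← sum_pow_subgroup_units]
  rw [Finset.prod_univ_sum, Fintype.piFinset_univ]
  have hmem : ∀ i, ∀ j, ∃ u : A j, ((u : Kˣ) : K) = P i j := fun i j => by
    have h : P i ∈ Set.range P := ⟨i, rfl⟩
    rw [hrange] at h
    obtain ⟨u, hu, hu'⟩ := h j
    exact ⟨⟨u, hu⟩, hu'⟩
  choose g hg using hmem
  simp only [sumEval, LinearMap.sum_apply, AlgHom.toLinearMap_apply, aeval_monomial, map_one,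
    one_mul]
  refine Finset.sum_bij (fun i _ => g i) (fun _ _ => Finset.mem_univ _) ?_ ?_ ?_
  · intro i _ i' _ h
    apply hP
    ext j
    rw [← hg, ← hg, h]
  · intro u _
    have h : (fun j => ((u j : Kˣ) : K)) ∈ Set.range P := by
      rw [hrange]
      exact fun j => ⟨u j, (u j).2, rfl⟩
    obtain ⟨i, hi⟩ := h
    refine ⟨i, Finset.mem_univ _, ?_⟩
    ext j
    rw [hg, hi]
  · intro i _
    rw [Finsupp.prod_fintype _ _ fun _ => pow_zero _]
    simp only [hg]

/-- The exponents of standard monomials of a degenerate torus lie in the box `c j < |A j|`. -/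
theorem lt_card_of_mem_stdMon_degenerate_torus [Finite K]
    (A : Fin s → Subgroup Kˣ) (P : Fin m → (Fin s → K))
    (hrange : Set.range P = {x : Fin s → K | ∀ i, ∃ u ∈ A i, (u : K) = x i})
    (mo : MonomialOrder (Fin s)) {c : Fin s →₀ ℕ}
    (hc : c ∈ stdMon mo (vanishingIdeal P)) (j : Fin s) : c j < Nat.card (A j) := by
  classical
  by_contra! hlt
  apply hc
  set n := Nat.card (A j)
  have hn0 : n ≠ 0 := Nat.card_pos.ne'
  have hne : Finsupp.single j n ≠ 0 := by simpa using hn0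
  let f : MvPolynomial (Fin s) K := monomial (Finsupp.single j n) 1 - monomial 0 1
  have hsupp : f.support = {Finsupp.single j n, 0} := by
    ext e
    simp only [f, mem_support_iff, coeff_sub, coeff_monomial, Finset.mem_insert,
      Finset.mem_singleton]
    by_cases h1 : e = Finsupp.single j n
    · simp [h1, hne.symm]
    · simp [h1, Ne.symm h1, eq_comm]
  have hf0 : f ≠ 0 := by
    rw [← support_nonempty, hsupp]
    simp
  have hlead : leadExpo mo f = Finsupp.single j n := by
    rw [leadExpo, hsupp]
    simp
  have hfI : f ∈ vanishingIdeal P := by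
    simp only [_root_.vanishingIdeal, Ideal.mem_iInf, RingHom.mem_ker]
    intro i
    have h : P i ∈ Set.range P := ⟨i, rfl⟩
    rw [hrange] at h
    obtain ⟨u, hu, hu'⟩ := h j
    have hpow : u ^ n = 1 :=
      congrArg Subtype.val (pow_card_eq_one' (x := (⟨u, hu⟩ : A j)))
    have hprod : (Finsupp.single j n).prod (fun l e => P i l ^ e) = 1 := by
      rw [Finsupp.prod_single_index (by exact pow_zero _), ← hu', ← Units.val_pow_eq_pow_val, hpow,
        Units.val_one]
    simp only [f, map_sub, eval_monomial, Finsupp.prod_zero_index, hprod, sub_self]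
  have hmem : monomial (Finsupp.single j n) (1 : K) ∈ initialIdeal mo (vanishingIdeal P) :=
    Ideal.subset_span ⟨f, ⟨hfI, hf0⟩, by rw [← hlead]⟩
  have hsplit : monomial c (1 : K) =
      monomial (c - Finsupp.single j n) 1 * monomial (Finsupp.single j n) 1 := by
    rw [monomial_mul, one_mul, tsub_add_cancel_of_le (Finsupp.single_le_iff.2 hlt)]
  rw [hsplit]
  exact Ideal.mul_mem_left _ _ hmem

/-- Two residues `x, y < n` have sum divisible by `n` exactly when `x` is the complement of `y`. -/
theorem dvd_add_iff_eq_complement {n x y z : ℕ} (hx : x < n) (hy : y < n)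
    (hz : y ≠ 0 → z = n - y) (hz0 : y = 0 → z = 0) : n ∣ x + y ↔ x = z := by
  constructor
  · rintro ⟨r, hr⟩
    rcases r with _ | _ | r
    · have : x = 0 ∧ y = 0 := by omega
      rw [hz0 this.2, this.1]
    · by_cases h : y = 0
      · omega
      · rw [hz h]; omega
    · nlinarith
  · rintro rfl
    by_cases h : y = 0
    · simp [h, hz0 h]
    · rw [hz h, Nat.sub_add_cancel hy.le]

/-- Monomial basis for the algebraic dual of a monomial code on a degenerate torus. -/
theorem algDual_degenerate_torus [Fintype K]
    (A : Fin s → Subgroup Kˣ) (d : Fin s → ℕ) (hd : ∀ i, d i = Nat.card (A i))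
    (P : Fin m → (Fin s → K)) (hP : Function.Injective P)
    (hrange : Set.range P = {x : Fin s → K | ∀ i, ∃ u ∈ A i, (u : K) = x i})
    (mo : MonomialOrder (Fin s)) (hmo : mo.IsGraded)
    {k : ℕ} (a : Fin k → (Fin s →₀ ℕ)) (hainj : Function.Injective a)
    (ha : ∀ i, a i ∈ stdMon mo (vanishingIdeal P))
    (b : Fin k → (Fin s →₀ ℕ))
    (hb : ∀ i j, a i j ≠ 0 → b i j = d j - a i j)
    (hb0 : ∀ i j, a i j = 0 → b i j = 0) :
    algDual P mo (Submodule.span K (Set.range fun i => monomial (a i) (1 : K))) =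
      Submodule.span K
        ((fun c => monomial c (1 : K)) ''
          (stdMon mo (vanishingIdeal P) \ Set.range b)) := by
  classical
  have hbox : ∀ c ∈ stdMon mo (vanishingIdeal P), ∀ j, c j < d j := fun c hc j => by
    rw [hd]
    exact lt_card_of_mem_stdMon_degenerate_torus A P hrange mo hc j
  have hpair : ∀ c ∈ stdMon mo (vanishingIdeal P), ∀ i,
      sumEval P (monomial (c + a i) (1 : K)) = if c = b i then ∏ j, (d j : K) else 0 := by
    intro c hc i
    have hiff : ∀ j, d j ∣ (c + a i) j ↔ c j = b i j := fun j =>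
      dvd_add_iff_eq_complement (hbox c hc j) (hbox _ (ha i) j) (hb i j) (hb0 i j)
    rw [sumEval_monomial_degenerate_torus A P hP hrange]
    simp only [← hd, hiff]
    split_ifs with h
    · simp [h]
    · obtain ⟨j, hj⟩ := DFunLike.ne_iff.1 h
      exact Finset.prod_eq_zero (Finset.mem_univ j) (if_neg hj)
  have hd0 : ∏ j, (d j : K) ≠ 0 := Finset.prod_ne_zero_iff.2 fun j _ => by
    rw [hd]
    exact natCast_card_subgroup_units_ne_zero (A j)
  have hsum : ∀ g : MvPolynomial (Fin s) K,
      (g.support : Set (Fin s →₀ ℕ)) ⊆ stdMon mo (vanishingIdeal P) → ∀ i,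
        sumEval P (g * monomial (a i) 1) = coeff (b i) g * ∏ j, (d j : K) := by
    intro g hg i
    conv_lhs => rw [g.as_sum, Finset.sum_mul, map_sum]
    have : ∀ c ∈ g.support, sumEval P (monomial c (coeff c g) * monomial (a i) 1) =
        if c = b i then coeff (b i) g * ∏ j, (d j : K) else 0 := by
      intro c hc
      rw [monomial_mul, ← smul_eq_mul, ← smul_monomial, map_smul, hpair c (hg hc) i]
      split_ifs with h <;> simp [h]
    rw [Finset.sum_congr rfl this, Finset.sum_ite_eq']
    split_ifs with h
    · rfl
    · rw [notMem_support_iff.1 h, zero_mul]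
  ext g
  rw [algDual, stdSpan, ← restrictSupport_eq_span, ← restrictSupport_eq_span, Submodule.mem_inf,
    mem_restrictSupport_iff, mem_restrictSupport_iff, and_comm,
    Set.subset_sdiff]
  refine and_congr_right fun hg => ?_
  have hcolon : g ∈ colonKer (sumEval P)
      (Submodule.span K (Set.range fun i => monomial (a i) (1 : K))) ↔
      ∀ i, sumEval P (g * monomial (a i) 1) = 0 := by
    refine ⟨fun h i => h _ (Submodule.subset_span ⟨i, rfl⟩), fun h => ?_⟩
    have : Submodule.span K (Set.range fun i => monomial (a i) (1 : K)) ≤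
        LinearMap.ker ((sumEval P).comp (LinearMap.mulLeft K g)) := by
      rw [Submodule.span_le]
      rintro _ ⟨i, rfl⟩
      exact h i
    exact fun f hf => this hf
  rw [hcolon, Set.disjoint_right, Set.forall_mem_range]
  refine forall_congr' fun i => ?_
  rw [hsum g hg, mul_eq_zero, or_iff_left hd0, Finset.mem_coe, notMem_support_iff]

end
end
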